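/- Let D be a nonempty convex open set in ℝ^d satisfying Condition A with constant c > 0. Then for every continuous w : [0,∞) → ℝ^d with w(0) ∈ D̄ there exists a solution (X, φ) of the Skorohod equation X = w + φ, and there are constants K, K' > 0 depending only on c such that for all 0 ≤ s < t: |X(t) − X(s)| ≤ K Δ_{s,t} and |φ|(t) − |φ|(s) ≤ K' Δ_{s,t}, where Δ_{s,t} = sup_{s ≤ t₁ < t₂ ≤ t} |w(t₂) − w(t₁)|. -/

import Mathlib

open MeasureTheory Set Filter Topology
open scoped RealInnerProductSpace

noncomputable section

abbrev Euc (d : ℕ) := EuclideanSpace ℝ (Fin d)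

/-- Measure data representing the Lebesgue–Stieltjes measures `dφ` (componentwise, as a
difference of locally finite nonnegative measures) and `d|φ|` (the total variation measure)
of a function `φ : [0,∞) → ℝ^d` of locally bounded variation. -/
structure BVMeasureData (d : ℕ) (φ : ℝ → Euc d) where
  pos : Fin d → Measure ℝ
  neg : Fin d → Measure ℝ
  var : Measure ℝ
  pos_fin : ∀ i : Fin d, ∀ t : ℝ, pos i (Icc 0 t) < ⊤
  neg_fin : ∀ i : Fin d, ∀ t : ℝ, neg i (Icc 0 t) < ⊤
  increments : ∀ i : Fin d, ∀ s t : ℝ, 0 ≤ s → s ≤ t →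
    (pos i (Ioc s t)).toReal - (neg i (Ioc s t)).toReal = φ t i - φ s i
  var_eq : ∀ s t : ℝ, 0 ≤ s → s ≤ t → var (Ioc s t) = eVariationOn φ (Icc s t)

/-- The Stieltjes integral `∫_{(s,t]} ⟨f(τ), dφ(τ)⟩`. -/
def BVMeasureData.pairing {d : ℕ} {φ : ℝ → Euc d} (M : BVMeasureData d φ)
    (f : ℝ → Euc d) (s t : ℝ) : ℝ :=
  ∑ i : Fin d, ((∫ τ in Ioc s t, f τ i ∂(M.pos i)) - ∫ τ in Ioc s t, f τ i ∂(M.neg i))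

/-- `f` is right-continuous at every `t ≥ 0`. -/
def RightContinuousOnNonneg {E : Type*} [TopologicalSpace E] (f : ℝ → E) : Prop :=
  ∀ t : ℝ, 0 ≤ t → ContinuousWithinAt f (Ici t) t

/-- `f` has left limits at every `t > 0`. -/
def HasLeftLimitsOnPos {E : Type*} [TopologicalSpace E] (f : ℝ → E) : Prop :=
  ∀ t : ℝ, 0 < t → ∃ L, Tendsto f (𝓝[<] t) (𝓝 L)

/-- `φ` is associated with `X` (relative to the convex domain `D`):
`φ` is rcll of locally bounded variation with `φ(0) = 0`, the measure `d|φ|` does not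
charge `{t ≥ 0 : X(t) ∈ D}`, and `∫_{(s,t]} ⟨η(τ) − X(τ), dφ(τ)⟩ ≥ 0` for every
continuous `η : [0,∞) → closure D`. -/
structure IsAssociated {d : ℕ} (D : Set (Euc d)) (X : ℝ → Euc d) (φ : ℝ → Euc d)
    (M : BVMeasureData d φ) : Prop where
  rightCont : RightContinuousOnNonneg φ
  leftLim : HasLeftLimitsOnPos φ
  bv : ∀ t : ℝ, 0 ≤ t → eVariationOn φ (Icc 0 t) < ⊤
  init : φ 0 = 0
  carried : M.var {t : ℝ | 0 ≤ t ∧ X t ∈ D} = 0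
  normal : ∀ η : ℝ → Euc d, Continuous η → (∀ t : ℝ, 0 ≤ t → η t ∈ closure D) →
    ∀ s t : ℝ, 0 ≤ s → s ≤ t → 0 ≤ M.pairing (fun τ => η τ - X τ) s t

/-- `(X, φ)` (with measure data `M` for `φ`) solves the Skorohod equation `X = w + φ`
for the domain `D`. -/
structure IsSkorohodSolution {d : ℕ} (D : Set (Euc d)) (w X φ : ℝ → Euc d)
    (M : BVMeasureData d φ) : Prop where
  rightCont : RightContinuousOnNonneg X
  leftLim : HasLeftLimitsOnPos X
  mem : ∀ t : ℝ, 0 ≤ t → X t ∈ closure D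
  eqn : ∀ t : ℝ, 0 ≤ t → X t = w t + φ t
  assoc : IsAssociated D X φ M


/-- The set of inward unit normal vectors to the convex set `D` at a boundary point `x`. -/
def innerNormals {d : ℕ} (D : Set (Euc d)) (x : Euc d) : Set (Euc d) :=
  {n | ‖n‖ = 1 ∧ ∀ y ∈ closure D, 0 ≤ ⟪y - x, n⟫}

/-- `Δ_{s,t} = sup_{s ≤ t₁ < t₂ ≤ t} |w(t₂) − w(t₁)|`. -/
def oscDelta {d : ℕ} (w : ℝ → Euc d) (s t : ℝ) : ℝ :=
  sSup {r : ℝ | ∃ t₁ t₂ : ℝ, s ≤ t₁ ∧ t₁ < t₂ ∧ t₂ ≤ t ∧ r = ‖w t₂ - w t₁‖}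

namespace SkA

section discrete
variable {E : Type*} [NormedAddCommGroup E] [InnerProductSpace ℝ E]

lemma energy (z Y : ℕ → E) (h0 : Y 0 = z 0)
    (h : ∀ k, ⟪Y (k+1), (Y (k+1) - z (k+1)) - (Y k - z k)⟫ ≤ 0) (n : ℕ) (δ : ℝ)
    (hδ : ∀ k < n, ‖z n - z (k+1)‖ ≤ δ) :
    ‖Y n‖^2 ≤ ‖z n‖^2 +
      2 * δ * ∑ k ∈ Finset.range n, ‖(Y (k+1) - z (k+1)) - (Y k - z k)‖ := by
  set B : ℕ → E := fun k => Y k - z k with hB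
  have hB0 : B 0 = 0 := by simp [hB, h0]
  have h1 : ∀ m, ‖B m‖^2 ≤ 2 * ∑ k ∈ Finset.range m, ⟪B (k+1), B (k+1) - B k⟫ := by
    intro m
    induction m with
    | zero => simp [hB0]
    | succ m ih =>
      rw [Finset.sum_range_succ]
      have e1 : ‖B (m+1) - B m‖^2 = ‖B (m+1)‖^2 - 2 * ⟪B (m+1), B m⟫ + ‖B m‖^2 :=
        norm_sub_sq_real _ _
      have e2 : ⟪B (m+1), B (m+1) - B m⟫ = ‖B (m+1)‖^2 - ⟪B (m+1), B m⟫ := by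
        rw [inner_sub_right, real_inner_self_eq_norm_sq]
      nlinarith [sq_nonneg ‖B (m+1) - B m‖]
  have h2 : ∀ m, B m = ∑ k ∈ Finset.range m, (B (k+1) - B k) := by
    intro m; rw [Finset.sum_range_sub, hB0, sub_zero]
  have h3 : ⟪z n, B n⟫ = ∑ k ∈ Finset.range n, ⟪z n, B (k+1) - B k⟫ := by
    conv_lhs => rw [h2 n]
    rw [inner_sum]
  have h4 : ‖Y n‖^2 = ‖z n‖^2 + 2 * ⟪z n, B n⟫ + ‖B n‖^2 := by
    have : Y n = z n + B n := by simp [hB]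
    rw [this, norm_add_sq_real]
  have h5 : ∑ k ∈ Finset.range n, ⟪z n, B (k+1) - B k⟫ +
      ∑ k ∈ Finset.range n, ⟪B (k+1), B (k+1) - B k⟫ ≤
      δ * ∑ k ∈ Finset.range n, ‖B (k+1) - B k‖ := by
    rw [← Finset.sum_add_distrib, Finset.mul_sum]
    refine Finset.sum_le_sum fun k hk => ?_
    have e1 : ⟪z n, B (k+1) - B k⟫ + ⟪B (k+1), B (k+1) - B k⟫ =
        ⟪z n - z (k+1), B (k+1) - B k⟫ + ⟪Y (k+1), B (k+1) - B k⟫ := by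
      rw [← inner_add_left, ← inner_add_left]
      congr 1
      simp only [hB]; abel
    rw [e1]
    have := h k
    have e2 := real_inner_le_norm (z n - z (k+1)) (B (k+1) - B k)
    have e3 := mul_le_mul_of_nonneg_right (hδ k (Finset.mem_range.1 hk))
      (norm_nonneg (B (k+1) - B k))
    have e4 : ⟪Y (k+1), B (k+1) - B k⟫ ≤ 0 := this
    linarith
  have := h1 n
  change _ ≤ _ + 2 * δ * ∑ k ∈ Finset.range n, ‖B (k+1) - B k‖
  nlinarith

def DSol (C : Set E) (u X : ℕ → E) : Prop :=
  (∀ k, X k ∈ C) ∧ ∀ k, ∀ y ∈ C, 0 ≤ ⟪y - X (k+1), (X (k+1) - u (k+1)) - (X k - u k)⟫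

def Cone (C : Set E) (e : E) (c : ℝ) : Prop :=
  ∀ x ∈ C, ∀ a, (∀ y ∈ C, 0 ≤ ⟪y - x, a⟫) → c * ‖a‖ ≤ ⟪e, a⟫

lemma DSol.exists [CompleteSpace E] {C : Set E} (hC : IsClosed C) (hconv : Convex ℝ C)
    (u : ℕ → E) (h0 : u 0 ∈ C) : ∃ X, DSol C u X ∧ X 0 = u 0 := by
  have hp : ∀ v : E, ∃ p ∈ C, ∀ y ∈ C, 0 ≤ ⟪y - p, p - v⟫ := by
    intro v
    obtain ⟨p, hp, h⟩ := exists_norm_eq_iInf_of_complete_convex ⟨_, h0⟩ hC.isComplete hconv v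
    rw [norm_eq_iInf_iff_real_inner_le_zero hconv hp] at h
    refine ⟨p, hp, fun y hy => ?_⟩
    have := h y hy
    rw [← neg_sub v p, inner_neg_right, real_inner_comm]
    linarith
  choose P hP1 hP2 using hp
  let X : ℕ → E := fun k => Nat.rec (u 0) (fun k x => P (x + (u (k+1) - u k))) k
  have hX : ∀ k, X (k+1) = P (X k + (u (k+1) - u k)) := fun k => rfl
  refine ⟨X, ⟨fun k => ?_, fun k y hy => ?_⟩, rfl⟩
  · cases k with
    | zero => exact h0
    | succ k => rw [hX]; exact hP1 _
  · have := hP2 (X k + (u (k+1) - u k)) y hy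
    rw [← hX] at this
    convert this using 2
    abel

lemma DSol.shift {C : Set E} {u X : ℕ → E} (h : DSol C u X) (j : ℕ) :
    DSol C (fun k => u (j+k)) (fun k => X (j+k)) :=
  ⟨fun k => h.1 _, fun k y hy => h.2 (j+k) y hy⟩

lemma DSol.div {C : Set E} {u X : ℕ → E} (h : DSol C u X) (r : ℕ) :
    DSol C (fun k => u (k/r)) (fun k => X (k/r)) := by
  refine ⟨fun k => h.1 _, fun k y hy => ?_⟩
  rcases (show (k+1)/r = k/r ∨ (k+1)/r = k/r+1 by
    rw [Nat.succ_div]; split_ifs <;> simp) with h1 | h1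
  · simp [h1]
  · simp only [h1]; exact h.2 _ y hy

lemma DSol.step {C : Set E} {u X : ℕ → E} {e : E} {c : ℝ} (h : DSol C u X)
    (hA : Cone C e c) (k : ℕ) :
    c * ‖(X (k+1) - u (k+1)) - (X k - u k)‖ ≤ ⟪e, (X (k+1) - u (k+1)) - (X k - u k)⟫ :=
  hA _ (h.1 _) _ (h.2 k)

lemma DSol.tv {C : Set E} {u X : ℕ → E} {e : E} {c : ℝ} (h : DSol C u X)
    (hA : Cone C e c) (n : ℕ) :
    c * ∑ k ∈ Finset.range n, ‖(X (k+1) - u (k+1)) - (X k - u k)‖ ≤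
      ⟪e, (X n - u n) - (X 0 - u 0)⟫ := by
  rw [Finset.mul_sum, ← Finset.sum_range_sub (fun k => X k - u k), inner_sum]
  exact Finset.sum_le_sum fun k _ => h.step hA k

lemma DSol.incr {C : Set E} {u X : ℕ → E} {e : E} {c : ℝ} (h : DSol C u X) (hc : 0 < c)
    (hA : Cone C e c) (n : ℕ) :
    c * ‖(X n - u n) - (X 0 - u 0)‖ ≤ ⟪e, (X n - u n) - (X 0 - u 0)⟫ := by
  refine le_trans ?_ (h.tv hA n)
  rw [← Finset.sum_range_sub (fun k => X k - u k)]
  exact mul_le_mul_of_nonneg_left (norm_sum_le _ _) hc.le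

/-- growth estimate -/
lemma DSol.growth {C : Set E} {u X : ℕ → E} {e : E} {c : ℝ} (h : DSol C u X) (hc : 0 < c)
    (he : ‖e‖ = 1) (hA : Cone C e c) (n : ℕ) (δ : ℝ)
    (hδ : ∀ k ≤ n, ‖u n - u k‖ ≤ δ) :
    ‖X n - X 0‖ ≤ (1 + 2/c) * δ ∧
      ⟪e, (X n - u n) - (X 0 - u 0)⟫ ≤ (2 + 2/c) * δ := by
  set S := ∑ k ∈ Finset.range n, ‖(X (k+1) - u (k+1)) - (X k - u k)‖ with hS
  have hδ0 : 0 ≤ δ := by simpa using hδ n le_rfl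
  have h1 := h.tv hA n
  rw [← hS] at h1
  have h2 : ⟪e, (X n - u n) - (X 0 - u 0)⟫ ≤ ‖X n - X 0‖ + δ := by
    have a1 := real_inner_le_norm e ((X n - u n) - (X 0 - u 0))
    rw [he, one_mul] at a1
    have a2 : (X n - u n) - (X 0 - u 0) = (X n - X 0) - (u n - u 0) := by abel
    have a3 := norm_sub_le (X n - X 0) (u n - u 0)
    rw [← a2] at a3
    linarith [hδ 0 (Nat.zero_le _)]
  have h3 := energy (fun k => u k - u 0) (fun k => X k - X 0) (by simp) (fun k => by
      have := h.2 k (X 0) (h.1 0)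
      have e1 : (X (k+1) - X 0 - (u (k+1) - u 0)) - (X k - X 0 - (u k - u 0)) =
        (X (k+1) - u (k+1)) - (X k - u k) := by abel
      rw [e1, ← neg_sub (X 0), inner_neg_left]
      linarith) n δ (fun k hk => by simpa using hδ (k+1) hk)
  have e2 : ∀ k, (X (k+1) - X 0 - (u (k+1) - u 0)) - (X k - X 0 - (u k - u 0)) =
        (X (k+1) - u (k+1)) - (X k - u k) := fun k => by abel
  simp only [e2] at h3
  rw [← hS] at h3
  have h4 := hδ 0 (Nat.zero_le _)
  set x := ‖X n - X 0‖ with hx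
  have hx0 : 0 ≤ x := norm_nonneg _
  have h5 : ‖u n - u 0‖^2 ≤ δ^2 := by gcongr
  have h6 : S ≤ (x + δ)/c := by rw [le_div_iff₀ hc]; linarith
  have h7 : x^2 ≤ δ^2 + 2*δ*((x+δ)/c) := by
    have : 2*δ*S ≤ 2*δ*((x+δ)/c) := by gcongr
    linarith
  have h8 : x ≤ (1 + 2/c) * δ := by
    by_contra hcon
    push Not at hcon
    have : (x + δ) * (x - (1+2/c)*δ) ≤ 0 := by
      have : (x + δ) * (x - (1+2/c)*δ) = x^2 - (δ^2 + 2*δ*((x+δ)/c)) := by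
        field_simp; ring
      linarith
    have h9 : 0 ≤ (1+2/c)*δ := by positivity
    have : 0 < (x + δ) * (x - (1+2/c)*δ) := mul_pos (by linarith) (by linarith)
    linarith
  exact ⟨h8, by linarith⟩

/-- comparison estimate -/
lemma DSol.compare {C : Set E} {u X u' X' : ℕ → E} (h : DSol C u X) (h' : DSol C u' X')
    {e : E} {c : ℝ} (hc : 0 < c)
    (hA : Cone C e c) (h0 : X 0 = u 0) (h0' : X' 0 = u' 0) (n : ℕ) (δ R : ℝ)
    (hδ : ∀ k ≤ n, ‖u k - u' k‖ ≤ δ)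
    (hR : ⟪e, (X n - u n) - (X 0 - u 0)⟫ ≤ R) (hR' : ⟪e, (X' n - u' n) - (X' 0 - u' 0)⟫ ≤ R) :
    ‖X n - X' n‖^2 ≤ δ^2 + 8 * δ * R / c := by
  have hδ0 : 0 ≤ δ := (norm_nonneg _).trans (hδ n le_rfl)
  have e2 : ∀ k, (X (k+1) - X' (k+1) - (u (k+1) - u' (k+1))) - (X k - X' k - (u k - u' k)) =
        ((X (k+1) - u (k+1)) - (X k - u k)) - ((X' (k+1) - u' (k+1)) - (X' k - u' k)) :=
    fun k => by abel
  have h3 := energy (fun k => u k - u' k) (fun k => X k - X' k) (by simp [h0, h0']) (fun k => by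
      have a1 := h.2 k (X' (k+1)) (h'.1 _)
      have a2 := h'.2 k (X (k+1)) (h.1 _)
      rw [e2, inner_sub_right]
      rw [← neg_sub (X (k+1)), inner_neg_left] at a1
      linarith) n (2*δ) (fun k hk => by
        have a1 := hδ n le_rfl
        have a2 := hδ (k+1) hk
        have := norm_sub_le (u n - u' n) (u (k+1) - u' (k+1))
        linarith)
  simp only [e2] at h3
  have h4 : ∑ k ∈ Finset.range n, ‖((X (k+1) - u (k+1)) - (X k - u k)) -
      ((X' (k+1) - u' (k+1)) - (X' k - u' k))‖ ≤ 2 * R / c := by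
    have b1 := h.tv hA n
    have b2 := h'.tv hA n
    rw [le_div_iff₀ hc]
    have : ∑ k ∈ Finset.range n, ‖((X (k+1) - u (k+1)) - (X k - u k)) -
      ((X' (k+1) - u' (k+1)) - (X' k - u' k))‖ ≤
      ∑ k ∈ Finset.range n, ‖(X (k+1) - u (k+1)) - (X k - u k)‖ +
      ∑ k ∈ Finset.range n, ‖(X' (k+1) - u' (k+1)) - (X' k - u' k)‖ := by
      rw [← Finset.sum_add_distrib]
      exact Finset.sum_le_sum fun k _ => norm_sub_le _ _
    nlinarith
  have h5 : ‖u n - u' n‖^2 ≤ δ^2 := by gcongr; exact hδ n le_rfl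
  have h6 := mul_le_mul_of_nonneg_left h4 (show 0 ≤ 2 * (2*δ) by positivity)
  have h7 : 2 * (2*δ) * (2*R/c) = 8 * δ * R / c := by ring
  linarith

/-- normal estimate -/
lemma DSol.normal {C : Set E} {u X : ℕ → E} {e : E} {c : ℝ} (h : DSol C u X) (hc : 0 < c)
    (hA : Cone C e c) (n : ℕ) (ε : ℝ) (hε0 : 0 ≤ ε)
    (hε : ∀ k < n, ‖X n - X (k+1)‖ ≤ ε) (y : E) (hy : y ∈ C) :
    -(ε * (⟪e, (X n - u n) - (X 0 - u 0)⟫ / c)) ≤ ⟪y - X n, (X n - u n) - (X 0 - u 0)⟫ := by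
  have h1 := h.tv hA n
  have h2 : -(ε * ∑ k ∈ Finset.range n, ‖(X (k+1) - u (k+1)) - (X k - u k)‖) ≤
      ⟪y - X n, (X n - u n) - (X 0 - u 0)⟫ := by
    rw [← Finset.sum_range_sub (fun k => X k - u k), inner_sum, Finset.mul_sum,
      ← Finset.sum_neg_distrib]
    refine Finset.sum_le_sum fun k hk => ?_
    have a1 := h.2 k y hy
    have a2 : y - X n = (y - X (k+1)) - (X n - X (k+1)) := by abel
    rw [a2, inner_sub_left]
    have a3 := real_inner_le_norm (X n - X (k+1)) ((X (k+1) - u (k+1)) - (X k - u k))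
    have a4 := mul_le_mul_of_nonneg_right (hε k (Finset.mem_range.1 hk))
      (norm_nonneg ((X (k+1) - u (k+1)) - (X k - u k)))
    linarith
  have h3 : ∑ k ∈ Finset.range n, ‖(X (k+1) - u (k+1)) - (X k - u k)‖ ≤
    ⟪e, (X n - u n) - (X 0 - u 0)⟫ / c := by rw [le_div_iff₀ hc]; linarith
  have := mul_le_mul_of_nonneg_left h3 hε0
  linarith

end discrete
end SkA

namespace SkA

section limit
variable {E : Type*} [NormedAddCommGroup E] [InnerProductSpace ℝ E]

def ix (n : ℕ) (t : ℝ) : ℕ := ⌊t * 2^n⌋₊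

lemma ix_mono (n : ℕ) {s t : ℝ} (h : s ≤ t) : ix n s ≤ ix n t := by
  unfold ix; gcongr

lemma ix_zero (n : ℕ) : ix n 0 = 0 := by simp [ix]

lemma le_of_le_ix {n k : ℕ} {t : ℝ} (hk : k ≠ 0) (h : k ≤ ix n t) : (k:ℝ)/2^n ≤ t := by
  rw [div_le_iff₀ (by positivity)]
  exact (Nat.le_floor_iff' hk).1 h

lemma lt_of_ix_lt {n k : ℕ} {t : ℝ} (h : ix n t < k) : t < (k:ℝ)/2^n := by
  rw [lt_div_iff₀ (by positivity)]
  exact Nat.lt_of_floor_lt h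

lemma ix_div {n m : ℕ} (h : n ≤ m) (t : ℝ) : ix n t = ix m t / 2^(m-n) := by
  unfold ix
  have : t * 2^n = t * 2^m / ((2^(m-n) : ℕ) : ℝ) := by
    push_cast
    rw [eq_div_iff (by positivity), mul_assoc, ← pow_add]
    congr 2; omega
  rw [this, Nat.floor_div_natCast]

lemma tendsto_ix (t : ℝ) : Tendsto (fun n => (ix n t : ℝ)/2^n) atTop (𝓝 (max t 0)) := by
  have h0 : Tendsto (fun n : ℕ => (1/2:ℝ)^n) atTop (𝓝 0) :=
    tendsto_pow_atTop_nhds_zero_of_lt_one (by norm_num) (by norm_num)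
  have hl : Tendsto (fun n : ℕ => max t 0 - (1/2:ℝ)^n) atTop (𝓝 (max t 0)) := by
    simpa using tendsto_const_nhds.sub h0
  refine tendsto_of_tendsto_of_tendsto_of_le_of_le hl tendsto_const_nhds ?_ ?_
  · intro n
    have hp : (0:ℝ) < 2^n := by positivity
    have h1 : t * 2^n < ix n t + 1 := Nat.lt_floor_add_one _
    show max t 0 - (1/2:ℝ)^n ≤ ix n t / 2^n
    rw [one_div, inv_pow, le_div_iff₀ hp, sub_mul, inv_mul_cancel₀ hp.ne', max_mul_of_nonneg _ _ hp.le]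
    have : (0:ℝ) ≤ ix n t := Nat.cast_nonneg _
    rw [sub_le_iff_le_add]
    apply max_le <;> linarith
  · intro n
    show (ix n t : ℝ) / 2^n ≤ max t 0
    rcases Nat.eq_zero_or_pos (ix n t) with h | h
    · simp [h]
    · exact (le_of_le_ix h.ne' le_rfl).trans (le_max_left _ _)

theorem cauchy {C : Set E} {e : E} {c : ℝ} (hc : 0 < c) (he : ‖e‖ = 1) (hA : Cone C e c)
    {w : ℝ → E} (hw : Continuous w) (Xs : ℕ → ℕ → E)
    (hX : ∀ n, DSol C (fun k => w (k/2^n)) (Xs n)) (hX0 : ∀ n, Xs n 0 = w 0)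
    (T : ℝ) (hT : 0 ≤ T) (ε : ℝ) (hε : 0 < ε) :
    ∃ N, ∀ n ≥ N, ∀ m ≥ n, ∀ t ≤ T, ‖Xs n (ix n t) - Xs m (ix m t)‖ ≤ ε := by
  obtain ⟨B, hB⟩ := (isCompact_Icc (a := (0:ℝ)) (b := T)).exists_bound_of_continuousOn
    hw.continuousOn
  have hB0 : 0 ≤ B := (norm_nonneg _).trans (hB 0 ⟨le_rfl, hT⟩)
  set R := (2 + 2/c) * (2*B) with hR
  have hR0 : 0 ≤ R := by positivity
  set δ := min 1 (ε^2/(1+8*R/c)) with hδ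
  have hδ0 : 0 < δ := by positivity
  have hδ1 : δ^2 + 8*δ*R/c ≤ ε^2 := by
    have h1 : δ ≤ 1 := min_le_left _ _
    have h2 : δ ≤ ε^2/(1+8*R/c) := min_le_right _ _
    rw [le_div_iff₀ (by positivity)] at h2
    have : δ * (1 + 8*R/c) = δ + 8*δ*R/c := by ring
    nlinarith
  have huc := (isCompact_Icc (a := (0:ℝ)) (b := T)).uniformContinuousOn_of_continuous
    hw.continuousOn
  obtain ⟨ρ, hρ, hwρ⟩ := Metric.uniformContinuousOn_iff.1 huc δ hδ0
  obtain ⟨N, hN⟩ := exists_pow_lt_of_lt_one hρ (show (1/2:ℝ) < 1 by norm_num)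
  refine ⟨N, fun n hn m hm t ht => ?_⟩
  have hmem : ∀ k ≤ ix m t, ((k:ℝ)/2^m) ∈ Icc 0 T := by
    intro k hk
    refine ⟨by positivity, ?_⟩
    rcases Nat.eq_zero_or_pos k with h | h
    · simp [h, hT]
    · exact (le_of_le_ix h.ne' hk).trans ht
  have hcast : (2:ℝ)^m = ((2^(m-n) : ℕ) : ℝ) * 2^n := by
    push_cast; rw [← pow_add]; congr 1; omega
  set r := 2^(m-n) with hr
  have hr0 : 0 < r := by positivity
  have hdec : ∀ k : ℕ, (k:ℝ)/2^m = ((k/r : ℕ):ℝ)/2^n + ((k%r : ℕ) : ℝ)/2^m := by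
    intro k
    have h1 : (k:ℝ) = r * (k/r : ℕ) + (k % r : ℕ) := by
      exact_mod_cast (Nat.div_add_mod k r).symm
    have h2 : ((k/r : ℕ):ℝ)/2^n = (r * (k/r : ℕ))/2^m := by
      rw [hcast]
      have : (r:ℝ) ≠ 0 := by positivity
      field_simp
    rw [h2, ← add_div, ← h1]
  have hmem' : ∀ k ≤ ix m t, (((k/r : ℕ):ℝ)/2^n) ∈ Icc 0 T := by
    intro k hk
    refine ⟨by positivity, ?_⟩
    have h1 := hdec k
    have h2 : (0:ℝ) ≤ ((k%r : ℕ) : ℝ)/2^m := by positivity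
    linarith [(hmem k hk).2]
  have hdist : ∀ k ≤ ix m t, ‖w (((k/r : ℕ):ℝ)/2^n) - w ((k:ℝ)/2^m)‖ ≤ δ := by
    intro k hk
    rw [← dist_eq_norm]
    refine (hwρ _ (hmem' k hk) _ (hmem k hk) ?_).le
    rw [dist_comm, Real.dist_eq, hdec k, add_sub_cancel_left, abs_of_nonneg (by positivity)]
    refine lt_of_lt_of_le ?_ ((pow_le_pow_of_le_one (by norm_num) (by norm_num) hn).trans hN.le)
    rw [hcast, div_lt_iff₀ (by positivity), one_div, inv_pow]
    have : ((k % r : ℕ):ℝ) < r := by exact_mod_cast Nat.mod_lt k hr0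
    have h3 : ((2:ℝ)^n)⁻¹ * (r * 2^n) = r := by field_simp
    rwa [h3]
  have hb : ∀ a ∈ Icc 0 T, ∀ b ∈ Icc 0 T, ‖w a - w b‖ ≤ 2*B := by
    intro a ha b hb
    have := norm_sub_le (w a) (w b)
    linarith [hB a ha, hB b hb]
  have hD := (hX n).div r
  have g1 := (hD.growth hc he hA (ix m t) (2*B)
    (fun k hk => hb _ (hmem' _ le_rfl) _ (hmem' _ hk))).2
  have g2 := ((hX m).growth hc he hA (ix m t) (2*B)
    (fun k hk => hb _ (hmem _ le_rfl) _ (hmem _ hk))).2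
  have key := hD.compare (hX m) hc hA (by simp [hX0]) (by simp [hX0]) (ix m t) δ R
    hdist g1 g2
  rw [ix_div hm t]
  exact abs_le_of_sq_le_sq' (key.trans hδ1) hε.le |>.2

theorem exists_limit [CompleteSpace E] {C : Set E} (hC : IsClosed C) (hconv : Convex ℝ C)
    {e : E} {c : ℝ} (hc : 0 < c) (he : ‖e‖ = 1) (hA : Cone C e c)
    {w : ℝ → E} (hw : Continuous w) (hw0 : w 0 ∈ C) (hneg : ∀ t ≤ 0, w t = w 0) :
    ∃ X : ℝ → E, X 0 = w 0 ∧ (∀ t, X t ∈ C) ∧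
      (∀ s t, s ≤ t → c * ‖(X t - w t) - (X s - w s)‖ ≤ ⟪e, (X t - w t) - (X s - w s)⟫) ∧
      (∀ s t δ, s ≤ t → (∀ τ ∈ Icc s t, ‖w t - w τ‖ ≤ δ) →
        ‖X t - X s‖ ≤ (1 + 2/c) * δ ∧ ⟪e, (X t - w t) - (X s - w s)⟫ ≤ (2 + 2/c) * δ) ∧
      (∀ s t ε, s ≤ t → (∀ τ ∈ Icc s t, ‖X t - X τ‖ ≤ ε) → ∀ y ∈ C,
        -(ε * (⟪e, (X t - w t) - (X s - w s)⟫ / c)) ≤ ⟪y - X t, (X t - w t) - (X s - w s)⟫) := by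
  have hex : ∀ n : ℕ, ∃ Z : ℕ → E, DSol C (fun k => w (k/2^n)) Z ∧ Z 0 = w ((0:ℕ)/2^n) := fun n =>
    DSol.exists hC hconv _ (by simpa using hw0)
  choose Xs hX hX0 using hex
  replace hX0 : ∀ n, Xs n 0 = w 0 := fun n => by rw [hX0]; simp
  have hcau := cauchy hc he hA hw Xs hX hX0
  have hlim : ∀ t, ∃ x, Tendsto (fun n => Xs n (ix n t)) atTop (𝓝 x) := by
    intro t
    apply cauchySeq_tendsto_of_complete
    rw [Metric.cauchySeq_iff']
    intro ε hε
    obtain ⟨N, hN⟩ := hcau (max t 0) (le_max_right _ _) (ε/2) (half_pos hε)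
    refine ⟨N, fun n hn => ?_⟩
    rw [dist_comm, dist_eq_norm]
    linarith [hN N le_rfl n hn t (le_max_left _ _)]
  choose X hXlim using hlim
  have hunif : ∀ T ε : ℝ, 0 < ε → ∃ N, ∀ n ≥ N, ∀ t ≤ T, ‖Xs n (ix n t) - X t‖ ≤ ε := by
    intro T ε hε
    obtain ⟨N, hN⟩ := hcau (max T 0) (le_max_right _ _) ε hε
    refine ⟨N, fun n hn t ht => ?_⟩
    refine le_of_tendsto (tendsto_const_nhds.sub (hXlim t)).norm ?_
    filter_upwards [eventually_ge_atTop n] with m hm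
    exact hN n hn m hm t (ht.trans (le_max_left _ _))
  have hwlim : ∀ t, Tendsto (fun n => w ((ix n t : ℝ)/2^n)) atTop (𝓝 (w t)) := by
    intro t
    have h1 := (hw.tendsto _).comp (tendsto_ix t)
    have h2 : w (max t 0) = w t := by
      rcases le_total t 0 with h | h
      · rw [max_eq_right h, hneg t h]
      · rw [max_eq_left h]
    rwa [h2] at h1
  have hφ : ∀ s t, Tendsto (fun n => (Xs n (ix n t) - w ((ix n t : ℝ)/2^n)) -
      (Xs n (ix n s) - w ((ix n s : ℝ)/2^n))) atTop (𝓝 ((X t - w t) - (X s - w s))) := fun s t =>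
    ((hXlim t).sub (hwlim t)).sub ((hXlim s).sub (hwlim s))
  have hshift : ∀ n s, DSol C (fun k => w ((ix n s + k : ℕ)/2^n)) (fun k => Xs n (ix n s + k)) :=
    fun n s => (hX n).shift (ix n s)
  have hadd : ∀ n {s t}, s ≤ t → ix n s + (ix n t - ix n s) = ix n t := fun n {s t} h => by
    have := ix_mono n h; omega
  refine ⟨X, ?_, ?_, ?_, ?_, ?_⟩
  · refine tendsto_nhds_unique (hXlim 0) ?_
    simp [ix_zero, hX0]
  · exact fun t => hC.mem_of_tendsto (hXlim t) (Eventually.of_forall fun n => (hX n).1 _)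
  · intro s t hst
    refine le_of_tendsto_of_tendsto' ((hφ s t).norm.const_mul c)
      (tendsto_const_nhds.inner (hφ s t)) fun n => ?_
    have := (hshift n s).incr hc hA (ix n t - ix n s)
    simpa only [hadd n hst, add_zero] using this
  · intro s t δ hst hδ
    have hδlim : Tendsto (fun n => δ + ‖w ((ix n t : ℝ)/2^n) - w t‖ +
        ‖w s - w ((ix n s : ℝ)/2^n)‖) atTop (𝓝 δ) := by
      have := (((hwlim t).sub_const (w t)).norm.const_add δ).add
        ((hwlim s).const_sub (w s)).norm
      simpa using this
    have key : ∀ n, ‖Xs n (ix n t) - Xs n (ix n s)‖ ≤ (1 + 2/c) *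
        (δ + ‖w ((ix n t : ℝ)/2^n) - w t‖ + ‖w s - w ((ix n s : ℝ)/2^n)‖) ∧
        ⟪e, (Xs n (ix n t) - w ((ix n t : ℝ)/2^n)) -
      (Xs n (ix n s) - w ((ix n s : ℝ)/2^n))⟫ ≤ (2 + 2/c) *
        (δ + ‖w ((ix n t : ℝ)/2^n) - w t‖ + ‖w s - w ((ix n s : ℝ)/2^n)‖) := by
      intro n
      have := (hshift n s).growth hc he hA (ix n t - ix n s)
        (δ + ‖w ((ix n t : ℝ)/2^n) - w t‖ + ‖w s - w ((ix n s : ℝ)/2^n)‖) (by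
          intro k hk
          simp only [hadd n hst]
          have hk2 : ix n s + k ≤ ix n t := by have := hadd n hst; omega
          rcases Nat.eq_zero_or_pos k with h | h
          · subst h
            have a1 := hδ s ⟨le_rfl, hst⟩
            simp only [add_zero]
            calc _ = ‖(w ((ix n t : ℝ)/2^n) - w t) + (w t - w s) +
                (w s - w ((ix n s : ℝ)/2^n))‖ := by congr 1; abel
              _ ≤ _ := norm_add₃_le
              _ ≤ _ := by linarith
          · have a1 := hδ (((ix n s + k : ℕ) : ℝ)/2^n) ⟨(lt_of_ix_lt (by omega)).le,
              le_of_le_ix (by omega) hk2⟩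
            calc _ = ‖(w ((ix n t : ℝ)/2^n) - w t) +
                (w t - w (((ix n s + k : ℕ) : ℝ)/2^n))‖ := by congr 1; abel
              _ ≤ _ := norm_add_le _ _
              _ ≤ _ := by linarith [norm_nonneg (w s - w ((ix n s : ℝ)/2^n))])
      simpa only [hadd n hst, add_zero] using this
    exact ⟨le_of_tendsto_of_tendsto' ((hXlim t).sub (hXlim s)).norm (hδlim.const_mul _)
      fun n => (key n).1, le_of_tendsto_of_tendsto' (tendsto_const_nhds.inner (hφ s t))
      (hδlim.const_mul _) fun n => (key n).2⟩
  · intro s t ε hst hε y hy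
    have hε0 : 0 ≤ ε := by simpa using hε t ⟨hst, le_rfl⟩
    have key : ∀ ρ > 0, -((ε + 2*ρ) * (⟪e, (X t - w t) - (X s - w s)⟫ / c)) ≤
        ⟪y - X t, (X t - w t) - (X s - w s)⟫ := by
      intro ρ hρ
      obtain ⟨N, hN⟩ := hunif t ρ hρ
      have l1 := (((tendsto_const_nhds (x := e)).inner (hφ s t)).div_const c).const_mul (ε + 2*ρ)
      refine le_of_tendsto_of_tendsto l1.neg
        (((hXlim t).const_sub y).inner (hφ s t)) ?_
      filter_upwards [eventually_ge_atTop N] with n hn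
      have := (hshift n s).normal hc hA (ix n t - ix n s) (ε + 2*ρ) (by positivity) (by
        intro k hk
        simp only [hadd n hst]
        have hk2 : ix n s + (k+1) ≤ ix n t := by have := hadd n hst; omega
        set τ : ℝ := ((ix n s + (k+1) : ℕ) : ℝ)/2^n with hτ
        have hmem : τ ∈ Icc s t := ⟨(lt_of_ix_lt (by omega)).le, le_of_le_ix (by omega) hk2⟩
        have hixτ : ix n τ = ix n s + (k+1) := by
          rw [hτ]; unfold ix
          rw [div_mul_cancel₀ _ (by positivity), Nat.floor_natCast]
        rw [← hixτ]
        have a1 := hN n hn t le_rfl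
        have a2 := hN n hn τ hmem.2
        have a3 := hε τ hmem
        rw [norm_sub_rev] at a2
        calc _ = ‖(Xs n (ix n t) - X t) + (X t - X τ) + (X τ - Xs n (ix n τ))‖ := by
              congr 1; abel
          _ ≤ _ := norm_add₃_le
          _ ≤ _ := by linarith) y hy
      simpa only [hadd n hst, add_zero] using this
    have l2 : Tendsto (fun ρ : ℝ => -((ε + 2*ρ) * (⟪e, (X t - w t) - (X s - w s)⟫ / c))) (𝓝[>] 0)
        (𝓝 (-((ε + 2*0) * (⟪e, (X t - w t) - (X s - w s)⟫ / c)))) := by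
      refine Tendsto.mono_left (Continuous.tendsto ?_ _) nhdsWithin_le_nhds
      fun_prop
    have := le_of_tendsto l2 (by filter_upwards [self_mem_nhdsWithin] with ρ hρ using key ρ hρ)
    simpa using this

end limit
end SkA

namespace SkA

section final
variable {d : ℕ}

def stj (g : ℝ → ℝ) (hm : Monotone g) (hc : Continuous g) : StieltjesFunction ℝ where
  toFun := g
  mono' := hm
  right_continuous' := fun _ => hc.continuousWithinAt

lemma stj_Ioc (g : ℝ → ℝ) (hm : Monotone g) (hc : Continuous g) (a b : ℝ) :
    (stj g hm hc).measure (Ioc a b) = ENNReal.ofReal (g b - g a) :=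
  (stj g hm hc).measure_Ioc a b

lemma eVar_le {φ : ℝ → Euc d} {g : ℝ → ℝ} (hm : Monotone g)
    (hg : ∀ s t, s ≤ t → ‖φ t - φ s‖ ≤ g t - g s) (a b : ℝ) (hab : a ≤ b) :
    eVariationOn φ (Icc a b) ≤ ENNReal.ofReal (g b - g a) := by
  have h1 : eVariationOn g (Icc a b) = ENNReal.ofReal (g b - g a) := by
    have := (hm.monotoneOn (Icc a b)).eVariationOn_eq (left_mem_Icc.2 hab) (right_mem_Icc.2 hab)
    rwa [inter_self] at this
  rw [← h1]
  unfold eVariationOn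
  refine iSup_mono fun p => Finset.sum_le_sum fun i _ => ?_
  have h2 := hg _ _ (p.2.2.1 (Nat.le_succ i))
  rw [edist_dist, edist_dist, dist_eq_norm, Real.dist_eq]
  exact ENNReal.ofReal_le_ofReal (h2.trans (le_abs_self _))

lemma eVar_add (φ : ℝ → Euc d) {a b c : ℝ} (hab : a ≤ b) (hbc : b ≤ c) :
    eVariationOn φ (Icc a b) + eVariationOn φ (Icc b c) = eVariationOn φ (Icc a c) := by
  have := eVariationOn.Icc_add_Icc φ (s := univ) hab hbc (mem_univ _)
  simpa only [univ_inter] using this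

lemma lbv {φ : ℝ → Euc d} {g : ℝ → ℝ} (hm : Monotone g)
    (hg : ∀ s t, s ≤ t → ‖φ t - φ s‖ ≤ g t - g s) : LocallyBoundedVariationOn φ univ := by
  intro a b _ _
  rw [univ_inter]
  rcases le_total a b with h | h
  · exact ((eVar_le hm hg a b h).trans_lt ENNReal.ofReal_lt_top).ne
  · exact (eVariationOn.subsingleton φ (subsingleton_Icc_of_ge h)).trans_ne (by simp)

def G (φ : ℝ → Euc d) : ℝ → ℝ := variationOnFromTo φ univ 0

lemma G_sub {φ : ℝ → Euc d} {g : ℝ → ℝ} (hm : Monotone g)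
    (hg : ∀ s t, s ≤ t → ‖φ t - φ s‖ ≤ g t - g s) (a b : ℝ) (hab : a ≤ b) :
    ENNReal.ofReal (G φ b - G φ a) = eVariationOn φ (Icc a b) := by
  have h1 := variationOnFromTo.add (lbv hm hg) (mem_univ 0) (mem_univ a) (mem_univ b)
  have h2 := variationOnFromTo.eq_of_le φ univ hab
  rw [univ_inter] at h2
  have h3 : G φ b - G φ a = (eVariationOn φ (Icc a b)).toReal := by
    rw [← h2]; unfold G; linarith
  rw [h3, ENNReal.ofReal_toReal]
  exact ((eVar_le hm hg a b hab).trans_lt ENNReal.ofReal_lt_top).ne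

lemma G_mono {φ : ℝ → Euc d} {g : ℝ → ℝ} (hm : Monotone g)
    (hg : ∀ s t, s ≤ t → ‖φ t - φ s‖ ≤ g t - g s) : Monotone (G φ) :=
  monotoneOn_univ.1 (variationOnFromTo.monotoneOn (lbv hm hg) (mem_univ 0))

lemma G_cont {φ : ℝ → Euc d} {g : ℝ → ℝ} (hm : Monotone g) (hgc : Continuous g)
    (hg : ∀ s t, s ≤ t → ‖φ t - φ s‖ ≤ g t - g s) : Continuous (G φ) := by
  have h1 : ∀ s t, s ≤ t → G φ t - G φ s ≤ g t - g s := by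
    intro s t hst
    have h2 := eVar_le hm hg s t hst
    rw [← G_sub hm hg s t hst] at h2
    exact (ENNReal.ofReal_le_ofReal_iff (sub_nonneg.2 (hm hst))).1 h2
  have h3 : ∀ s t, |G φ t - G φ s| ≤ |g t - g s| := by
    intro s t
    rcases le_total s t with h | h
    · rw [abs_of_nonneg (sub_nonneg.2 (G_mono hm hg h)), abs_of_nonneg (sub_nonneg.2 (hm h))]
      exact h1 s t h
    · rw [abs_sub_comm, abs_sub_comm (g t), abs_of_nonneg (sub_nonneg.2 (G_mono hm hg h)),
        abs_of_nonneg (sub_nonneg.2 (hm h))]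
      exact h1 t s h
  rw [continuous_iff_continuousAt]
  intro s
  rw [ContinuousAt, tendsto_iff_dist_tendsto_zero]
  have h4 := tendsto_iff_dist_tendsto_zero.1 (hgc.tendsto s)
  exact squeeze_zero (fun _ => dist_nonneg) (fun t => h3 s t) h4

lemma comp_mono {φ : ℝ → Euc d} {g : ℝ → ℝ}
    (hg : ∀ s t, s ≤ t → ‖φ t - φ s‖ ≤ g t - g s) (i : Fin d) :
    Monotone (fun t => φ t i + g t) := by
  intro s t hst
  have h1 := hg s t hst
  have h2 : ‖(φ t - φ s) i‖ ≤ ‖φ t - φ s‖ := PiLp.norm_apply_le _ i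
  rw [PiLp.sub_apply, Real.norm_eq_abs] at h2
  have := (abs_le.1 h2).1
  show φ s i + g s ≤ φ t i + g t
  linarith

lemma comp_cont {φ : ℝ → Euc d} {g : ℝ → ℝ} (hφ : Continuous φ) (hgc : Continuous g) (i : Fin d) :
    Continuous (fun t => φ t i + g t) := by fun_prop

def mkData (φ : ℝ → Euc d) (g : ℝ → ℝ) (hφ : Continuous φ) (hm : Monotone g) (hgc : Continuous g)
    (hg : ∀ s t, s ≤ t → ‖φ t - φ s‖ ≤ g t - g s) : BVMeasureData d φ where
  pos := fun i => (stj _ (comp_mono hg i) (comp_cont hφ hgc i)).measure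
  neg := fun _ => (stj g hm hgc).measure
  var := (stj _ (G_mono hm hg) (G_cont hm hgc hg)).measure
  pos_fin := fun _ _ => isCompact_Icc.measure_lt_top
  neg_fin := fun _ _ => isCompact_Icc.measure_lt_top
  increments := by
    intro i s t _ hst
    rw [stj_Ioc, stj_Ioc, ENNReal.toReal_ofReal (sub_nonneg.2 (comp_mono hg i hst)),
      ENNReal.toReal_ofReal (sub_nonneg.2 (hm hst))]
    ring
  var_eq := by
    intro s t _ hst
    rw [stj_Ioc, G_sub hm hg s t hst]

lemma int_approx (μ : Measure ℝ) [IsLocallyFiniteMeasure μ] (f : ℝ → ℝ) (hf : Continuous f)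
    (a b ε : ℝ) (h : ∀ τ ∈ Icc a b, |f τ - f b| ≤ ε) :
    |(∫ τ in Ioc a b, f τ ∂μ) - f b * μ.real (Ioc a b)| ≤ ε * μ.real (Ioc a b) := by
  have hfin : μ (Ioc a b) < ⊤ :=
    (measure_mono Ioc_subset_Icc_self).trans_lt isCompact_Icc.measure_lt_top
  have h1 : (∫ τ in Ioc a b, (f τ - f b) ∂μ) =
      (∫ τ in Ioc a b, f τ ∂μ) - f b * μ.real (Ioc a b) := by
    rw [integral_sub hf.integrableOn_Ioc (continuous_const.integrableOn_Ioc)]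
    simp [mul_comm]
  rw [← h1, ← Real.norm_eq_abs]
  refine norm_setIntegral_le_of_norm_le_const hfin fun τ hτ => ?_
  rw [Real.norm_eq_abs]
  exact h τ (Ioc_subset_Icc_self hτ)

lemma pairing_approx {φ : ℝ → Euc d} (M : BVMeasureData d φ)
    [∀ i, IsLocallyFiniteMeasure (M.pos i)] [∀ i, IsLocallyFiniteMeasure (M.neg i)]
    (g : ℝ → ℝ) (hp : ∀ i a b, a ≤ b → (M.pos i).real (Ioc a b) ≤ 2 * (g b - g a))
    (hn : ∀ i a b, a ≤ b → (M.neg i).real (Ioc a b) ≤ g b - g a)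
    (f : ℝ → Euc d) (hf : Continuous f) (a b ε : ℝ) (ha : 0 ≤ a) (hab : a ≤ b)
    (h : ∀ τ ∈ Icc a b, ‖f τ - f b‖ ≤ ε) :
    ⟪f b, φ b - φ a⟫ - d * (3 * ε * (g b - g a)) ≤ M.pairing f a b := by
  have hε0 : 0 ≤ ε := (norm_nonneg _).trans (h b ⟨hab, le_rfl⟩)
  unfold BVMeasureData.pairing
  have h1 : ⟪f b, φ b - φ a⟫ - d * (3 * ε * (g b - g a)) =
      ∑ i : Fin d, (f b i * (φ b i - φ a i) - 3 * ε * (g b - g a)) := by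
    rw [Finset.sum_sub_distrib, PiLp.inner_apply]
    simp [mul_comm]
  rw [h1]
  refine Finset.sum_le_sum fun i _ => ?_
  have h2 : ∀ τ ∈ Icc a b, |f τ i - f b i| ≤ ε := by
    intro τ hτ
    have : ‖(f τ - f b) i‖ ≤ ‖f τ - f b‖ := PiLp.norm_apply_le _ i
    rw [PiLp.sub_apply, Real.norm_eq_abs] at this
    exact this.trans (h τ hτ)
  have hfi : Continuous fun τ => f τ i := by fun_prop
  have h3 := (abs_le.1 (int_approx (M.pos i) (fun τ => f τ i) hfi a b ε h2)).1
  have h4 := (abs_le.1 (int_approx (M.neg i) (fun τ => f τ i) hfi a b ε h2)).2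
  have h5 := M.increments i a b ha hab
  change (M.pos i).real (Ioc a b) - (M.neg i).real (Ioc a b) = _ at h5
  have h6 := mul_le_mul_of_nonneg_left (hp i a b hab) hε0
  have h7 := mul_le_mul_of_nonneg_left (hn i a b hab) hε0
  rw [← h5]
  simp only at h3 h4
  nlinarith

lemma pairing_add {φ : ℝ → Euc d} (M : BVMeasureData d φ)
    [∀ i, IsLocallyFiniteMeasure (M.pos i)] [∀ i, IsLocallyFiniteMeasure (M.neg i)]
    (f : ℝ → Euc d) (hf : Continuous f) (a b c : ℝ) (hab : a ≤ b) (hbc : b ≤ c) :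
    M.pairing f a c = M.pairing f a b + M.pairing f b c := by
  unfold BVMeasureData.pairing
  rw [← Finset.sum_add_distrib]
  refine Finset.sum_congr rfl fun i _ => ?_
  have hfi : Continuous fun τ => f τ i := by fun_prop
  rw [← Ioc_union_Ioc_eq_Ioc hab hbc,
    setIntegral_union (Ioc_disjoint_Ioc_of_le le_rfl) measurableSet_Ioc
      hfi.integrableOn_Ioc hfi.integrableOn_Ioc,
    setIntegral_union (Ioc_disjoint_Ioc_of_le le_rfl) measurableSet_Ioc
      hfi.integrableOn_Ioc hfi.integrableOn_Ioc]
  ring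

lemma pairing_nonneg {φ : ℝ → Euc d} (M : BVMeasureData d φ)
    [∀ i, IsLocallyFiniteMeasure (M.pos i)] [∀ i, IsLocallyFiniteMeasure (M.neg i)]
    (g : ℝ → ℝ) (hp : ∀ i a b, a ≤ b → (M.pos i).real (Ioc a b) ≤ 2 * (g b - g a))
    (hn : ∀ i a b, a ≤ b → (M.neg i).real (Ioc a b) ≤ g b - g a)
    (C : Set (Euc d)) (X : ℝ → Euc d) (hX : Continuous X)
    (h3 : ∀ s t ε, s ≤ t → (∀ τ ∈ Icc s t, ‖X t - X τ‖ ≤ ε) → ∀ y ∈ C,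
        -(ε * (g t - g s)) ≤ ⟪y - X t, φ t - φ s⟫)
    (η : ℝ → Euc d) (hη : Continuous η) (hηC : ∀ t, 0 ≤ t → η t ∈ C) (s t : ℝ) (hs : 0 ≤ s)
    (hst : s ≤ t) : 0 ≤ M.pairing (fun τ => η τ - X τ) s t := by
  have hf : Continuous (fun τ => η τ - X τ) := hη.sub hX
  have key : ∀ ε > 0, -((1 + 6 * d) * ε * (g t - g s)) ≤ M.pairing (fun τ => η τ - X τ) s t := by
    intro ε hε
    obtain ⟨δ₁, hδ₁, hX'⟩ := Metric.uniformContinuousOn_iff.1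
      ((isCompact_Icc (a := s) (b := t)).uniformContinuousOn_of_continuous hX.continuousOn) ε hε
    obtain ⟨δ₂, hδ₂, hη'⟩ := Metric.uniformContinuousOn_iff.1
      ((isCompact_Icc (a := s) (b := t)).uniformContinuousOn_of_continuous hη.continuousOn) ε hε
    set δ := min δ₁ δ₂ / 2 with hδ
    have hδ0 : 0 < δ := by positivity
    have hδ1 : δ < δ₁ := by have := min_le_left δ₁ δ₂; linarith
    have hδ2 : δ < δ₂ := by have := min_le_right δ₁ δ₂; linarith
    have loc : ∀ a b, s ≤ a → a ≤ b → b ≤ t → b - a ≤ δ →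
        -((1 + 6 * d) * ε * (g b - g a)) ≤ M.pairing (fun τ => η τ - X τ) a b := by
      intro a b hsa hab hbt hba
      have hbm : b ∈ Icc s t := ⟨hsa.trans hab, hbt⟩
      have c1 : ∀ τ ∈ Icc a b, ‖X b - X τ‖ ≤ ε := by
        intro τ hτ
        rw [← dist_eq_norm]
        refine (hX' b hbm τ ⟨hsa.trans hτ.1, hτ.2.trans hbt⟩ ?_).le
        rw [Real.dist_eq, abs_of_nonneg (sub_nonneg.2 hτ.2)]
        linarith [hτ.1]
      have c2 : ∀ τ ∈ Icc a b, ‖η b - η τ‖ ≤ ε := by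
        intro τ hτ
        rw [← dist_eq_norm]
        refine (hη' b hbm τ ⟨hsa.trans hτ.1, hτ.2.trans hbt⟩ ?_).le
        rw [Real.dist_eq, abs_of_nonneg (sub_nonneg.2 hτ.2)]
        linarith [hτ.1]
      have d1 := pairing_approx M g hp hn _ hf a b (2*ε) (hs.trans hsa) hab (by
        intro τ hτ
        have : (η τ - X τ) - (η b - X b) = (X b - X τ) - (η b - η τ) := by abel
        rw [this]
        have := norm_sub_le (X b - X τ) (η b - η τ)
        linarith [c1 τ hτ, c2 τ hτ])
      have d2 := h3 a b ε hab c1 (η b) (hηC b ((hs.trans hsa).trans hab))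
      linarith
    have ind : ∀ k : ℕ, ∀ b, s ≤ b → b ≤ t → b - s ≤ k * δ →
        -((1 + 6 * d) * ε * (g b - g s)) ≤ M.pairing (fun τ => η τ - X τ) s b := by
      intro k
      induction k with
      | zero =>
        intro b hsb hbt hb
        exact loc s b le_rfl hsb hbt (by simp at hb; linarith)
      | succ k ih =>
        intro b hsb hbt hb
        push_cast at hb
        set m := max s (b - δ) with hm
        have m1 : s ≤ m := le_max_left _ _
        have m2 : m ≤ b := max_le hsb (by linarith)
        have m3 : b - m ≤ δ := by have := le_max_right s (b - δ); linarith
        have m4 : m - s ≤ k * δ := by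
          have : (0:ℝ) ≤ k * δ := by positivity
          rw [sub_le_iff_le_add]
          apply max_le <;> linarith
        rw [pairing_add M _ hf s m b m1 m2]
        have e1 := ih m m1 (m2.trans hbt) m4
        have e2 := loc m b m1 m2 hbt m3
        linarith
    obtain ⟨k, hk⟩ := exists_nat_ge ((t - s)/δ)
    exact ind k t hst le_rfl (by rwa [div_le_iff₀ hδ0] at hk)
  have l2 : Tendsto (fun ε : ℝ => -((1 + 6 * d) * ε * (g t - g s))) (𝓝[>] 0)
      (𝓝 (-((1 + 6 * d) * 0 * (g t - g s)))) := by
    refine Tendsto.mono_left (Continuous.tendsto ?_ _) nhdsWithin_le_nhds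
    fun_prop
  have := le_of_tendsto l2 (by filter_upwards [self_mem_nhdsWithin] with ρ hρ using key ρ hρ)
  simpa using this

lemma cone_of {D : Set (Euc d)} (hD : IsOpen D) {c : ℝ} {e : Euc d}
    (hA : ∀ x ∈ frontier D, ∀ n ∈ innerNormals D x, c ≤ ⟪e, n⟫) : Cone (closure D) e c := by
  intro x hx a ha
  by_cases ha0 : a = 0
  · simp [ha0]
  have hna : 0 < ‖a‖ := norm_pos_iff.2 ha0
  have hxD : x ∉ D := by
    intro hxD
    obtain ⟨r, hr, hball⟩ := Metric.isOpen_iff.1 hD x hxD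
    have hy : x - (r/2/‖a‖) • a ∈ D := by
      apply hball
      rw [Metric.mem_ball, dist_eq_norm, sub_sub_cancel_left, norm_neg, norm_smul,
        Real.norm_eq_abs, abs_of_nonneg (by positivity), div_mul_cancel₀ _ hna.ne']
      linarith
    have := ha _ (subset_closure hy)
    rw [sub_sub_cancel_left, inner_neg_left, inner_smul_left, real_inner_self_eq_norm_sq] at this
    have h2 : 0 < (r/2/‖a‖) * ‖a‖^2 := by positivity
    simp at this
    linarith
  have hf : x ∈ frontier D := by rw [hD.frontier_eq]; exact ⟨hx, hxD⟩
  have := hA x hf (‖a‖⁻¹ • a) ⟨by rw [norm_smul, norm_inv, norm_norm, inv_mul_cancel₀ hna.ne'],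
    fun y hy => by
      rw [inner_smul_right]
      exact mul_nonneg (by positivity) (ha y hy)⟩
  rw [inner_smul_right, inv_mul_eq_div, le_div_iff₀ hna] at this
  exact this

lemma le_osc {w : ℝ → Euc d} (hw : ContinuousOn w (Ici 0)) {s t : ℝ} (hs : 0 ≤ s)
    {a b : ℝ} (ha : a ∈ Icc s t) (hb : b ∈ Icc s t) : ‖w a - w b‖ ≤ oscDelta w s t := by
  obtain ⟨B, hB⟩ := (isCompact_Icc (a := s) (b := t)).exists_bound_of_continuousOn
    (hw.mono fun x hx => hs.trans hx.1)
  have hbdd : BddAbove {r : ℝ | ∃ t₁ t₂ : ℝ, s ≤ t₁ ∧ t₁ < t₂ ∧ t₂ ≤ t ∧ r = ‖w t₂ - w t₁‖} := by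
    refine ⟨2*B, ?_⟩
    rintro r ⟨t₁, t₂, h1, h2, h3, rfl⟩
    have e1 := hB t₁ ⟨h1, h2.le.trans h3⟩
    have e2 := hB t₂ ⟨h1.trans h2.le, h3⟩
    linarith [norm_sub_le (w t₂) (w t₁)]
  rcases lt_trichotomy a b with h | h | h
  · rw [norm_sub_rev]
    exact le_csSup hbdd ⟨a, b, ha.1, h, hb.2, rfl⟩
  · subst h
    rw [sub_self, norm_zero]
    apply Real.sSup_nonneg
    rintro r ⟨t₁, t₂, h1, h2, h3, rfl⟩
    exact norm_nonneg _
  · exact le_csSup hbdd ⟨b, a, hb.1, h, ha.2, rfl⟩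

end final
end SkA

/-- **Lemma 4.1.6.** Suppose the nonempty convex open set `D ⊆ ℝ^d` satisfies Condition A:
there are a unit vector `e` and a constant `c > 0` with `⟨e, n⟩ ≥ c` for every inward unit
normal `n` at every boundary point. Then for every continuous `w : [0,∞) → ℝ^d` with
`w(0) ∈ closure D` the Skorohod equation `X = w + φ` has a solution, and, with constants
`K, K' > 0` depending only on `c`, `|X(t) − X(s)| ≤ K Δ_{s,t}` and
`|φ|(t) − |φ|(s) ≤ K' Δ_{s,t}` for all `0 ≤ s < t`. -/
theorem skorohod_exists_of_condition_A (c : ℝ) (hc : 0 < c) :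
    ∃ K K' : ℝ, 0 < K ∧ 0 < K' ∧
      ∀ (d : ℕ) (D : Set (Euc d)), D.Nonempty → Convex ℝ D → IsOpen D →
        (∃ e : Euc d, ‖e‖ = 1 ∧ ∀ x ∈ frontier D, ∀ n ∈ innerNormals D x, c ≤ ⟪e, n⟫) →
        ∀ w : ℝ → Euc d, ContinuousOn w (Ici 0) → w 0 ∈ closure D →
          ∃ (X φ : ℝ → Euc d) (M : BVMeasureData d φ),
            IsSkorohodSolution D w X φ M ∧
            ∀ s t : ℝ, 0 ≤ s → s < t →
              ‖X t - X s‖ ≤ K * oscDelta w s t ∧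
              (eVariationOn φ (Icc 0 t)).toReal - (eVariationOn φ (Icc 0 s)).toReal ≤
                K' * oscDelta w s t := by
  refine ⟨1 + 2/c, (2 + 2/c)/c, by positivity, by positivity, ?_⟩
  rintro d D hne hconv hopen ⟨e, he, hA⟩ w₀ hw₀ hw₀0
  have hcone := SkA.cone_of hopen hA
  set w : ℝ → Euc d := fun t => w₀ (max t 0) with hwdef
  have hw : Continuous w := by
    rw [← continuousOn_univ]
    exact hw₀.comp (by fun_prop) (fun x _ => mem_Ici.2 (le_max_right _ _))
  have hww : ∀ t, 0 ≤ t → w t = w₀ t := fun t ht => by simp [hwdef, max_eq_left ht]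
  obtain ⟨X, hX0, hXC, hmono, hgrow, hnorm⟩ := SkA.exists_limit isClosed_closure hconv.closure
    hc he hcone hw (by rw [hww 0 le_rfl]; exact hw₀0)
    (fun t ht => by simp [hwdef, max_eq_right ht])
  set φ : ℝ → Euc d := fun t => X t - w t with hφdef
  have hXc : Continuous X := by
    rw [continuous_iff_continuousAt]
    intro t₀
    rw [Metric.continuousAt_iff]
    intro ε hε
    set δ := ε / (2 * (1 + 2/c)) with hδ
    have hδ0 : 0 < δ := by positivity
    obtain ⟨ρ, hρ, h⟩ := Metric.continuousAt_iff.1 hw.continuousAt (δ/2) (half_pos hδ0)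
    refine ⟨ρ, hρ, fun {t} ht => ?_⟩
    have hosc : ∀ a b, dist a t₀ < ρ → dist b t₀ < ρ → ‖w a - w b‖ ≤ δ := by
      intro a b ha hb
      rw [← dist_eq_norm]
      have := dist_triangle_right (w a) (w b) (w t₀)
      linarith [h ha, h hb]
    have hfin : (1 + 2/c) * δ < ε := by
      have : (1 + 2/c) * δ = ε/2 := by rw [hδ]; field_simp
      linarith
    have ht' := ht
    rw [Real.dist_eq, abs_lt] at ht'
    rcases le_total t t₀ with h1 | h1
    · have := (hgrow t t₀ δ h1 (fun τ hτ => hosc _ _ (by simpa using hρ) (by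
        rw [Real.dist_eq, abs_lt]; constructor <;> linarith [hτ.1, hτ.2]))).1
      rw [dist_comm, dist_eq_norm]
      linarith
    · have := (hgrow t₀ t δ h1 (fun τ hτ => hosc _ _ ht (by
        rw [Real.dist_eq, abs_lt]; constructor <;> linarith [hτ.1, hτ.2]))).1
      rw [dist_eq_norm]
      linarith
  have hφc : Continuous φ := hXc.sub hw
  set g : ℝ → ℝ := fun t => ⟪e, φ t⟫ / c with hgdef
  have hgc : Continuous g := by fun_prop
  have hgsub : ∀ s t, g t - g s = ⟪e, φ t - φ s⟫ / c := by
    intro s t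
    simp only [hgdef, inner_sub_right, sub_div]
  have hg : ∀ s t, s ≤ t → ‖φ t - φ s‖ ≤ g t - g s := by
    intro s t hst
    rw [hgsub, le_div_iff₀ hc, mul_comm]
    exact hmono s t hst
  have hgm : Monotone g := fun s t hst => sub_nonneg.1 ((norm_nonneg _).trans (hg s t hst))
  have hgle : ∀ s t, g t - g s ≤ ‖φ t - φ s‖ / c := by
    intro s t
    rw [hgsub]
    have := real_inner_le_norm e (φ t - φ s)
    rw [he, one_mul] at this
    gcongr
  have h3 : ∀ s t ε, s ≤ t → (∀ τ ∈ Icc s t, ‖X t - X τ‖ ≤ ε) → ∀ y ∈ closure D,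
        -(ε * (g t - g s)) ≤ ⟪y - X t, φ t - φ s⟫ := by
    intro s t ε hst h y hy
    rw [hgsub]
    exact hnorm s t ε hst h y hy
  set M := SkA.mkData φ g hφc hgm hgc hg with hM
  have hvar : ∀ a b, a ≤ b → M.var (Ioc a b) = eVariationOn φ (Icc a b) := by
    intro a b hab
    rw [← SkA.G_sub hgm hg a b hab]
    exact SkA.stj_Ioc _ _ _ _ _
  have hbv : ∀ a b, a ≤ b → eVariationOn φ (Icc a b) < ⊤ := fun a b hab =>
    (SkA.eVar_le hgm hg a b hab).trans_lt ENNReal.ofReal_lt_top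
  refine ⟨X, φ, M, ⟨fun t _ => hXc.continuousWithinAt, fun t _ => ⟨X t, hXc.continuousWithinAt⟩,
    fun t _ => hXC t, fun t ht => ?_, ⟨fun t _ => hφc.continuousWithinAt,
      fun t _ => ⟨φ t, hφc.continuousWithinAt⟩, fun t ht => hbv 0 t ht, ?_, ?_, ?_⟩⟩, ?_⟩
  · simp [hφdef, hww t ht]
  · simp [hφdef, hX0]
  · refine measure_null_of_locally_null _ fun t₀ ht₀ => ?_
    obtain ⟨r, hr, hball⟩ := Metric.isOpen_iff.1 hopen _ ht₀.2
    set ε := min (r/4) (r*c/4) with hεdef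
    have hε : 0 < ε := by positivity
    obtain ⟨ρ, hρ, h⟩ := Metric.continuousAt_iff.1 hXc.continuousAt (ε/2) (half_pos hε)
    refine ⟨Ioo (t₀ - ρ) (t₀ + ρ), mem_nhdsWithin_of_mem_nhds (Ioo_mem_nhds (by linarith)
      (by linarith)), ?_⟩
    have hconst : ∀ a b, t₀ - ρ < a → a ≤ b → b < t₀ + ρ → φ b = φ a := by
      intro a b ha hab hb
      have hd : ∀ τ ∈ Icc a b, dist (X τ) (X t₀) < ε/2 := fun τ hτ => h (by
        rw [Real.dist_eq, abs_lt]; constructor <;> linarith [hτ.1, hτ.2])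
      have hdb := hd b ⟨hab, le_rfl⟩
      by_contra hne'
      have hpos : 0 < ‖φ b - φ a‖ := norm_pos_iff.2 (sub_ne_zero.2 hne')
      set v := φ b - φ a with hv
      have hy : X b - (r/2/‖v‖) • v ∈ D := by
        apply hball
        rw [Metric.mem_ball]
        have e1 : dist (X b - (r/2/‖v‖) • v) (X b) = r/2 := by
          rw [dist_eq_norm, sub_sub_cancel_left, norm_neg, norm_smul,
            Real.norm_eq_abs, abs_of_nonneg (by positivity), div_mul_cancel₀ _ hpos.ne']
        have e2 := dist_triangle (X b - (r/2/‖v‖) • v) (X b) (X t₀)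
        have e3 : ε ≤ r/4 := min_le_left _ _
        linarith
      have k1 := h3 a b ε hab (fun τ hτ => by
        rw [← dist_eq_norm]
        have := dist_triangle_right (X b) (X τ) (X t₀)
        linarith [hd τ hτ]) _ (subset_closure hy)
      rw [sub_sub_cancel_left, inner_neg_left, ← hv, inner_smul_left,
        real_inner_self_eq_norm_sq] at k1
      have k2 : (r/2/‖v‖) * ‖v‖^2 = r/2 * ‖v‖ := by field_simp
      simp only [conj_trivial] at k1
      rw [k2] at k1
      have k3 := mul_le_mul_of_nonneg_left (hgle a b) hε.le
      have k4 : ε ≤ r*c/4 := min_le_right _ _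
      have k5 : ε * (‖v‖/c) ≤ r*c/4 * (‖v‖/c) := by gcongr
      have k6 : r*c/4 * (‖v‖/c) = r/4 * ‖v‖ := by field_simp
      have k7 : 0 < r * ‖v‖ := by positivity
      rw [← hv] at k3
      linarith
    have hconst' : ∀ a ∈ Icc (t₀ - ρ) (t₀ + ρ), φ a = φ t₀ := by
      have : Icc (t₀ - ρ) (t₀ + ρ) = closure (Ioo (t₀ - ρ) (t₀ + ρ)) :=
        (closure_Ioo (by linarith)).symm
      rw [this]
      intro a ha
      have hcl : IsClosed {a | φ a = φ t₀} := isClosed_eq hφc continuous_const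
      refine closure_minimal ?_ hcl ha
      intro b hb
      rcases le_total b t₀ with h1 | h1
      · exact (hconst b t₀ hb.1 h1 (by linarith)).symm
      · exact hconst t₀ b (by linarith) h1 hb.2
    refine measure_mono_null Ioo_subset_Ioc_self ?_
    rw [hvar _ _ (by linarith)]
    apply eVariationOn.constant_on
    rintro _ ⟨a, ha, rfl⟩ _ ⟨b, hb, rfl⟩
    rw [hconst' a ha, hconst' b hb]
  · intro η hη hηC s t hs hst
    have : ∀ i, IsLocallyFiniteMeasure (M.pos i) := fun i =>
      inferInstanceAs (IsLocallyFiniteMeasure (SkA.stj _ _ _).measure)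
    have : ∀ i, IsLocallyFiniteMeasure (M.neg i) := fun i =>
      inferInstanceAs (IsLocallyFiniteMeasure (SkA.stj _ _ _).measure)
    have hn : ∀ i a b, a ≤ b → (M.neg i).real (Ioc a b) = g b - g a := by
      intro i a b hab
      have : M.neg i (Ioc a b) = _ := SkA.stj_Ioc g hgm hgc a b
      rw [Measure.real, this, ENNReal.toReal_ofReal (sub_nonneg.2 (hgm hab))]
    refine SkA.pairing_nonneg M g ?_ (fun i a b hab => (hn i a b hab).le) (closure D) X hXc h3 η hη
      hηC s t hs hst
    intro i a b hab
    have : M.pos i (Ioc a b) = _ :=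
      SkA.stj_Ioc _ (SkA.comp_mono hg i) (SkA.comp_cont hφc hgc i) a b
    rw [Measure.real, this, ENNReal.toReal_ofReal (sub_nonneg.2 (SkA.comp_mono hg i hab))]
    have h2 : ‖(φ b - φ a) i‖ ≤ ‖φ b - φ a‖ := PiLp.norm_apply_le _ i
    rw [PiLp.sub_apply, Real.norm_eq_abs] at h2
    have := (abs_le.1 h2).2
    linarith [hg a b hab]
  · intro s t hs hst
    have hosc : ∀ τ ∈ Icc s t, ‖w t - w τ‖ ≤ oscDelta w₀ s t := by
      intro τ hτ
      rw [hww t (hs.trans hst.le), hww τ (hs.trans hτ.1)]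
      exact SkA.le_osc hw₀ hs ⟨hst.le, le_rfl⟩ hτ
    obtain ⟨g1, g2⟩ := hgrow s t _ hst.le hosc
    refine ⟨g1, ?_⟩
    have a1 := SkA.eVar_add φ hs hst.le
    rw [← a1, ENNReal.toReal_add (hbv 0 s hs).ne (hbv s t hst.le).ne, add_sub_cancel_left]
    have a2 := ENNReal.toReal_mono ENNReal.ofReal_ne_top (SkA.eVar_le hgm hg s t hst.le)
    rw [ENNReal.toReal_ofReal (sub_nonneg.2 (hgm hst.le)), hgsub] at a2
    refine a2.trans ?_
    rw [div_mul_eq_mul_div]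
    gcongr

end
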